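/- Assume (f_n) is a sequence of monotone non-expansive functions f_n : X → X converging pointwise to a function f : X → X, where f is a contraction, i.e. q-Lipschitz for some q < 1 in the supremum norm. Let (α_n), (β_n) be sequences in [0,1) with lim_{n→∞} α_n = 1, Σ_n (1−α_n) = ∞, and lim_{n→∞} β_n/(1−α_n) = 0. Let x_0 ∈ X and let (x_n) be the dampened Mann iteration with function sequence (f_n). If (x_n) is bounded, then (x_n) converges to the unique fixpoint of f. -/

import Mathlib

open Filter Set Topology

/-- The dampened Mann iteration:
`x₀ = x0`, `x_{n+1} = (1 - β n) • (α n • x n + (1 - α n) • f n (x n))`. -/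
noncomputable def mannSeq {E : Type*} [AddCommGroup E] [Module ℝ E]
    (α β : ℕ → ℝ) (f : ℕ → E → E) (x0 : E) : ℕ → E
  | 0 => x0
  | n + 1 => (1 - β n) • (α n • mannSeq α β f x0 n + (1 - α n) • f n (mannSeq α β f x0 n))

/-- A non-negative sequence satisfying `a (n + 1) ≤ (1 - t n) * a n + t n * η` eventually for every
`η > 0` tends to zero as soon as the weights `t n ∈ [0, 1]` are not summable. -/
theorem tendsto_zero_of_eventually_le_convex_comb {a t : ℕ → ℝ} (ha : ∀ n, 0 ≤ a n)
    (ht : ∀ n, t n ∈ Set.Icc (0 : ℝ) 1) (hdiv : ¬ Summable t)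
    (h : ∀ η > 0, ∀ᶠ n in atTop, a (n + 1) ≤ (1 - t n) * a n + t n * η) :
    Tendsto a atTop (𝓝 0) := by
  refine tendsto_order.2 ⟨fun r hr => Eventually.of_forall fun n => hr.trans_le (ha n),
    fun r hr => ?_⟩
  obtain ⟨N, hN⟩ := eventually_atTop.1 (h (r / 2) (half_pos hr))
  have hbound : ∀ k, a (k + N) - r / 2 ≤ a N * Real.exp (-∑ i ∈ Finset.range k, t (i + N)) := by
    intro k
    induction k with
    | zero => simp; linarith
    | succ k ih =>
      have h1 := hN (k + N) (by omega)
      have h2 := Real.one_sub_le_exp_neg (t (k + N))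
      have h3 : 0 ≤ a N * Real.exp (-∑ i ∈ Finset.range k, t (i + N)) :=
        mul_nonneg (ha N) (Real.exp_pos _).le
      have h4 : 0 ≤ 1 - t (k + N) := sub_nonneg.2 (ht _).2
      rw [Finset.sum_range_succ, neg_add, Real.exp_add, ← mul_assoc, add_right_comm]
      calc a (k + N + 1) - r / 2 ≤ (1 - t (k + N)) * (a (k + N) - r / 2) := by linarith
        _ ≤ (1 - t (k + N)) * (a N * Real.exp (-∑ i ∈ Finset.range k, t (i + N))) := by gcongr
        _ ≤ Real.exp (-t (k + N)) * (a N * Real.exp (-∑ i ∈ Finset.range k, t (i + N))) := by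
          gcongr
        _ = _ := mul_comm _ _
  have hsum : Tendsto (fun k => ∑ i ∈ Finset.range k, t (i + N)) atTop atTop :=
    (not_summable_iff_tendsto_nat_atTop_of_nonneg fun i => (ht (i + N)).1).1
      (mt (summable_nat_add_iff N).1 hdiv)
  have hlim : Tendsto (fun k => a N * Real.exp (-∑ i ∈ Finset.range k, t (i + N))) atTop (𝓝 0) := by
    simpa using (Real.tendsto_exp_neg_atTop_nhds_zero.comp hsum).const_mul (a N)
  refine (eventually_map (m := fun k => k + N) (P := fun n => a n < r)).2 ?_ |>.filter_mono
    (map_add_atTop_eq_nat N).ge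
  filter_upwards [hlim.eventually_lt_const (half_pos hr)] with k hk
  linarith [hbound k]

/-- Pointwise convergence of non-expansive maps to a non-expansive map is uniform on compact
sets. -/
theorem eventually_forall_dist_le_of_lipschitzOnWith {E F : Type*} [PseudoMetricSpace E]
    [PseudoMetricSpace F] {K : Set E} (hK : IsCompact K) {fn : ℕ → E → F} {f : E → F}
    (hfn : ∀ n, LipschitzOnWith 1 (fn n) K) (hf : LipschitzOnWith 1 f K)
    (hconv : ∀ x ∈ K, Tendsto (fun n => fn n x) atTop (𝓝 (f x))) {ε : ℝ} (hε : 0 < ε) :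
    ∀ᶠ n in atTop, ∀ x ∈ K, dist (fn n x) (f x) ≤ ε := by
  have hε3 : 0 < ε / 3 := by positivity
  obtain ⟨s, hsK, hs, hcover⟩ := hK.finite_cover_balls hε3
  have hev : ∀ᶠ n in atTop, ∀ y ∈ s, dist (fn n y) (f y) < ε / 3 :=
    hs.eventually_all.2 fun y hy => (tendsto_iff_dist_tendsto_zero.1
      (hconv y (hsK hy))).eventually_lt_const hε3
  filter_upwards [hev] with n hn x hx
  obtain ⟨y, hy, hxy⟩ := mem_iUnion₂.1 (hcover hx)
  have h1 := (hfn n).dist_le_mul x hx y (hsK hy)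
  have h2 := hf.dist_le_mul y (hsK hy) x hx
  have h3 := dist_triangle4 (fn n x) (fn n y) (f y) (f x)
  rw [Metric.mem_ball] at hxy
  rw [dist_comm y x] at h2
  simp only [NNReal.coe_one, one_mul] at h1 h2
  linarith [hn y hy]

/-- The dampened Mann iteration stays in a convex set that contains `0` and is invariant under all
the maps. -/
theorem mannSeq_mem {E : Type*} [AddCommGroup E] [Module ℝ E] {α β : ℕ → ℝ}
    (hα : ∀ n, α n ∈ Set.Icc (0 : ℝ) 1) (hβ : ∀ n, β n ∈ Set.Icc (0 : ℝ) 1) {X : Set E}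
    (hX : Convex ℝ X) (h0 : (0 : E) ∈ X) {f : ℕ → E → E} (hf : ∀ n, Set.MapsTo (f n) X X)
    {x0 : E} (hx0 : x0 ∈ X) (n : ℕ) : mannSeq α β f x0 n ∈ X := by
  induction n with
  | zero => exact hx0
  | succ n ih =>
    exact hX.smul_mem_of_zero_mem h0
      (hX ih (hf n ih) (hα n).1 (sub_nonneg.2 (hα n).2) (by ring))
      ⟨sub_nonneg.2 (hβ n).2, sub_le_self _ (hβ n).1⟩

/-- One dampened Mann step, measured against an arbitrary point `p`. -/
theorem norm_mann_step_sub_le {E : Type*} [NormedAddCommGroup E] [NormedSpace ℝ E] {a b : ℝ}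
    (ha : a ∈ Set.Icc (0 : ℝ) 1) (hb : b ∈ Set.Icc (0 : ℝ) 1) (x y p : E) :
    ‖(1 - b) • (a • x + (1 - a) • y) - p‖ ≤ a * ‖x - p‖ + (1 - a) * ‖y - p‖ + b * ‖p‖ := by
  have hb' : 0 ≤ 1 - b := sub_nonneg.2 hb.2
  have ha' : 0 ≤ 1 - a := sub_nonneg.2 ha.2
  have hsplit : (1 - b) • (a • x + (1 - a) • y) - p
      = (1 - b) • (a • (x - p) + (1 - a) • (y - p)) - b • p := by
    module
  calc ‖(1 - b) • (a • x + (1 - a) • y) - p‖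
      ≤ ‖(1 - b) • (a • (x - p) + (1 - a) • (y - p))‖ + ‖b • p‖ := hsplit ▸ norm_sub_le _ _
    _ = (1 - b) * ‖a • (x - p) + (1 - a) • (y - p)‖ + b * ‖p‖ := by
      rw [norm_smul_of_nonneg hb', norm_smul_of_nonneg hb.1]
    _ ≤ ‖a • (x - p) + (1 - a) • (y - p)‖ + b * ‖p‖ := by
      gcongr
      exact mul_le_of_le_one_left (norm_nonneg _) (sub_le_self _ hb.1)
    _ ≤ a * ‖x - p‖ + (1 - a) * ‖y - p‖ + b * ‖p‖ := by
      gcongr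
      refine (norm_add_le _ _).trans_eq ?_
      rw [norm_smul_of_nonneg ha.1, norm_smul_of_nonneg ha']

/-- if `f` is a contraction and `αₙ → 1`, `Σ (1 - αₙ) = ∞`,
`βₙ / (1 - αₙ) → 0`, then any bounded dampened Mann iteration with monotone
non-expansive approximations `fn → f` (pointwise) converges to the unique
fixpoint of `f`. -/
theorem mann_convergence_contraction_alpha_to_one
    (α β : ℕ → ℝ) (hα : ∀ n, α n ∈ Set.Ico (0 : ℝ) 1) (hβ : ∀ n, β n ∈ Set.Ico (0 : ℝ) 1)
    (hα1 : Tendsto α atTop (nhds 1))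
    (hαdiv : ¬ Summable (fun n => 1 - α n))
    (hβα : Tendsto (fun n => β n / (1 - α n)) atTop (nhds 0))
    (d : ℕ) (X : Set (Fin d → ℝ)) (hX : IsClosed X) (hXc : Convex ℝ X)
    (hpos : ∀ x ∈ X, ∀ i, 0 ≤ x i) (h0 : (0 : Fin d → ℝ) ∈ X)
    (f : (Fin d → ℝ) → (Fin d → ℝ)) (hmap : Set.MapsTo f X X)
    (q : NNReal) (hq : q < 1) (hcontr : LipschitzOnWith q f X)
    (fn : ℕ → (Fin d → ℝ) → (Fin d → ℝ))
    (hfnmap : ∀ n, Set.MapsTo (fn n) X X)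
    (hfnmono : ∀ n, ∀ x ∈ X, ∀ y ∈ X, x ≤ y → fn n x ≤ fn n y)
    (hfnne : ∀ n, LipschitzOnWith 1 (fn n) X)
    (hconv : ∀ x ∈ X, Tendsto (fun n => fn n x) atTop (nhds (f x)))
    (x0 : Fin d → ℝ) (hx0 : x0 ∈ X)
    (hbdd : ∃ C, ∀ n, ‖mannSeq α β fn x0 n‖ ≤ C) :
    ∃ xstar, xstar ∈ X ∧ f xstar = xstar ∧ (∀ y ∈ X, f y = y → y = xstar) ∧
      Tendsto (mannSeq α β fn x0) atTop (nhds xstar) := by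
  have hα' : ∀ n, α n ∈ Set.Icc (0 : ℝ) 1 := fun n => Ico_subset_Icc_self (hα n)
  have hβ' : ∀ n, β n ∈ Set.Icc (0 : ℝ) 1 := fun n => Ico_subset_Icc_self (hβ n)
  have hq1 : (q : ℝ) < 1 := mod_cast hq
  obtain ⟨p, hpX, hp, -⟩ := ContractingWith.exists_fixedPoint' hX.isComplete hmap
    ⟨hq, hcontr.mapsToRestrict hmap⟩ h0 (edist_ne_top _ _)
  have hp : f p = p := hp
  refine ⟨p, hpX, hp, fun y hy hfy => ?_, ?_⟩
  · have h := hcontr.dist_le_mul y hy p hpX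
    rw [hfy, hp] at h
    exact dist_le_zero.1 (by nlinarith [dist_nonneg (x := y) (y := p)])
  obtain ⟨C, hC⟩ := hbdd
  have hK : IsCompact (X ∩ Metric.closedBall 0 C) := (isCompact_closedBall 0 C).inter_left hX
  have hxX : ∀ n, mannSeq α β fn x0 n ∈ X := mannSeq_mem hα' hβ' hXc h0 hfnmap hx0
  have hxK : ∀ n, mannSeq α β fn x0 n ∈ X ∩ Metric.closedBall 0 C := fun n =>
    ⟨hxX n, mem_closedBall_zero_iff.2 (hC n)⟩
  rw [tendsto_iff_norm_sub_tendsto_zero]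
  refine tendsto_zero_of_eventually_le_convex_comb (t := fun n => (1 - α n) * (1 - q))
    (fun n => norm_nonneg _) (fun n => ⟨?_, ?_⟩) ?_ fun η hη => ?_
  · exact mul_nonneg (sub_nonneg.2 (hα' n).2) (sub_nonneg.2 hq1.le)
  · exact mul_le_one₀ (sub_le_self _ (hα n).1) (sub_nonneg.2 hq1.le) (sub_le_self _ q.2)
  · rwa [summable_mul_right_iff (sub_pos.2 hq1).ne']
  have hη' : 0 < η * (1 - q) / 2 := by have := sub_pos.2 hq1; positivity
  have hβp : Tendsto (fun n => β n / (1 - α n) * ‖p‖) atTop (𝓝 0) := by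
    simpa using hβα.mul_const ‖p‖
  filter_upwards [hβp.eventually_lt_const hη',
    eventually_forall_dist_le_of_lipschitzOnWith hK (fun n => (hfnne n).mono inter_subset_left)
      ((hcontr.weaken hq.le).mono inter_subset_left) (fun x hx => hconv x hx.1) hη'] with n hn hunif
  have hα1n : 0 < 1 - α n := sub_pos.2 (hα n).2
  have hstep := norm_mann_step_sub_le (hα' n) (hβ' n) (mannSeq α β fn x0 n)
    (fn n (mannSeq α β fn x0 n)) p
  have hdist : ‖fn n (mannSeq α β fn x0 n) - p‖
      ≤ η * (1 - q) / 2 + q * ‖mannSeq α β fn x0 n - p‖ := by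
    have h1 := hcontr.dist_le_mul _ (hxX n) p hpX
    rw [hp] at h1
    rw [← dist_eq_norm, ← dist_eq_norm]
    exact (dist_triangle _ _ _).trans (add_le_add (hunif _ (hxK n)) h1)
  have hβn : β n * ‖p‖ ≤ (1 - α n) * (η * (1 - q) / 2) := by
    rw [div_mul_eq_mul_div, div_lt_iff₀' hα1n] at hn
    exact hn.le
  have hmul := mul_le_mul_of_nonneg_left hdist hα1n.le
  rw [mannSeq]
  linarith
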